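/- Proposition 1. Under Assumptions 1–6 of the tensor factor model W_(3)t = U F_(3)t + E_(3)t, define the estimators as follows: let Γ̂ = (1/T)·Σ_{t=1}^T W_(3)t·W_(3)tᵀ, let M̂ be the r×r diagonal matrix of the r largest eigenvalues of Γ̂ and V̂ the m×r matrix whose columns are corresponding unit-norm eigenvectors, and set Û = V̂·M̂^{1/2} and F̂_(3)t = M̂^{−1/2}·V̂ᵀ·W_(3)t. Then, as m, T → ∞, there exists a (sample-dependent) r×r diagonal matrix Ĵ_r whose diagonal entries are each 1 or −1 such that (1/√m)·‖Û − U·Ĵ_r‖_F = O_p(max(1/√T, 1/m)) and, for each t, ‖F̂_(3)t − Ĵ_r·F_(3)t‖_F = O_p(max(1/√T, 1/√m)). -/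

import Mathlib

open MeasureTheory Matrix

/-- Frobenius norm of a real matrix. -/
noncomputable def frobNorm {a b : Type*} [Fintype a] [Fintype b]
    (A : Matrix a b ℝ) : ℝ :=
  Real.sqrt (∑ i, ∑ j, (A i j) ^ 2)

section FrobHelpers

open scoped Matrix.Norms.Frobenius

lemma frobNorm_eq_norm {a b : Type*} [Fintype a] [Fintype b] (A : Matrix a b ℝ) :
    frobNorm A = ‖A‖ := by
  rw [Matrix.frobenius_norm_def, frobNorm, Real.sqrt_eq_rpow]
  simp

lemma frobNorm_add_le {a b : Type*} [Fintype a] [Fintype b] (A B : Matrix a b ℝ) :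
    frobNorm (A + B) ≤ frobNorm A + frobNorm B := by
  simp only [frobNorm_eq_norm]; exact norm_add_le _ _

lemma frobNorm_mul_le {a b c : Type*} [Fintype a] [Fintype b] [Fintype c]
    (A : Matrix a b ℝ) (B : Matrix b c ℝ) :
    frobNorm (A * B) ≤ frobNorm A * frobNorm B := by
  simp only [frobNorm_eq_norm]; exact Matrix.frobenius_norm_mul _ _

lemma frobNorm_transpose {a b : Type*} [Fintype a] [Fintype b] (A : Matrix a b ℝ) :
    frobNorm Aᵀ = frobNorm A := by
  simp only [frobNorm_eq_norm]; exact Matrix.frobenius_norm_transpose _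

end FrobHelpers

lemma frobNorm_nonneg {a b : Type*} [Fintype a] [Fintype b] (A : Matrix a b ℝ) :
    0 ≤ frobNorm A := Real.sqrt_nonneg _

lemma frobNorm_sq {a b : Type*} [Fintype a] [Fintype b] (A : Matrix a b ℝ) :
    frobNorm A ^ 2 = ∑ i, ∑ j, (A i j) ^ 2 :=
  Real.sq_sqrt (Finset.sum_nonneg fun _ _ => Finset.sum_nonneg fun _ _ => sq_nonneg _)

lemma frobNorm_sq_trace {a b : Type*} [Fintype a] [Fintype b] (A : Matrix a b ℝ) :
    frobNorm A ^ 2 = (A * Aᵀ).trace := by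
  rw [frobNorm_sq]
  simp [Matrix.trace, Matrix.mul_apply, sq]

lemma frobNorm_diag_le {r : ℕ} (d : Fin r → ℝ) (c : ℝ) (hc : 0 ≤ c) (h : ∀ j, |d j| ≤ c) :
    frobNorm (Matrix.diagonal d) ≤ Real.sqrt r * c := by
  apply le_of_sq_le_sq _ (by positivity)
  rw [frobNorm_sq, mul_pow, Real.sq_sqrt (by positivity)]
  have : ∀ i, ∑ j, (Matrix.diagonal d i j) ^ 2 = d i ^ 2 := by
    intro i
    rw [Finset.sum_eq_single i]
    · simp
    · intro j _ hj; simp [Matrix.diagonal_apply_ne' d hj]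
    · simp
  simp only [this]
  calc ∑ i, d i ^ 2 ≤ ∑ _i : Fin r, c ^ 2 :=
        Finset.sum_le_sum fun i _ => sq_le_sq' (by linarith [(abs_le.1 (h i)).1]) (abs_le.1 (h i)).2
    _ = _ := by simp

lemma frobNorm_orth {m r : ℕ} (V : Matrix (Fin m) (Fin r) ℝ) (h : Vᵀ * V = 1) :
    frobNorm V = Real.sqrt r := by
  rw [← Real.sqrt_sq (frobNorm_nonneg V), frobNorm_sq_trace, Matrix.trace_mul_comm, h]
  simp

/-! dot-product facts -/

lemma dot_cs {n : ℕ} (x y : Fin n → ℝ) : (x ⬝ᵥ y) ^ 2 ≤ (x ⬝ᵥ x) * (y ⬝ᵥ y) := by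
  have := Finset.sum_mul_sq_le_sq_mul_sq Finset.univ x y
  simpa [dotProduct, sq] using this

lemma dot_self_nonneg {n : ℕ} (x : Fin n → ℝ) : 0 ≤ x ⬝ᵥ x :=
  Finset.sum_nonneg fun _ _ => mul_self_nonneg _

lemma dot_le_of_sq {n : ℕ} (x y : Fin n → ℝ) (b s : ℝ) (hb : 0 ≤ b) 
    (hx : x ⬝ᵥ x ≤ s) (hy : y ⬝ᵥ y ≤ b ^ 2 * s) : |x ⬝ᵥ y| ≤ b * s := by
  have hs : 0 ≤ s := (dot_self_nonneg x).trans hx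
  apply abs_le_of_sq_le_sq _ (by positivity)
  calc _ ≤ _ := dot_cs x y
    _ ≤ s * (b ^ 2 * s) := mul_le_mul hx hy (dot_self_nonneg _) hs
    _ = _ := by ring

lemma add_dot_bound {n : ℕ} (p q : Fin n → ℝ) (α β s : ℝ) (hα : 0 ≤ α) (hβ : 0 ≤ β) (hs : 0 ≤ s)
    (hp : p ⬝ᵥ p ≤ α ^ 2 * s) (hq : q ⬝ᵥ q ≤ β ^ 2 * s) :
    (p + q) ⬝ᵥ (p + q) ≤ (α + β) ^ 2 * s := by
  have h1 : |p ⬝ᵥ q| ≤ α * β * s := by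
    apply abs_le_of_sq_le_sq _ (by positivity)
    calc _ ≤ _ := dot_cs p q
      _ ≤ (α ^ 2 * s) * (β ^ 2 * s) := mul_le_mul hp hq (dot_self_nonneg _) (by positivity)
      _ = _ := by ring
  have h2 := (abs_le.1 h1).2
  simp only [add_dotProduct, dotProduct_add, dotProduct_comm q p]
  nlinarith

lemma mulVec_frob_bound {m n : ℕ} (D : Matrix (Fin m) (Fin n) ℝ) (x : Fin n → ℝ) :
    (D *ᵥ x) ⬝ᵥ (D *ᵥ x) ≤ frobNorm D ^ 2 * (x ⬝ᵥ x) := by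
  rw [frobNorm_sq, Finset.sum_mul]
  apply Finset.sum_le_sum
  intro i _
  have := dot_cs (D i) x
  simp only [mulVec, ← sq]
  refine this.trans (le_of_eq ?_)
  simp [dotProduct, sq]

lemma psd_mulVec_bound {m : ℕ} (S : Matrix (Fin m) (Fin m) ℝ) (hS : Sᵀ = S) (L : ℝ) (hL : 0 < L)
    (h0 : ∀ x, 0 ≤ x ⬝ᵥ S *ᵥ x) (h1 : ∀ x, x ⬝ᵥ S *ᵥ x ≤ L * (x ⬝ᵥ x)) (x : Fin m → ℝ) :
    (S *ᵥ x) ⬝ᵥ (S *ᵥ x) ≤ L ^ 2 * (x ⬝ᵥ x) := by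
  have hsym : ∀ u v : Fin m → ℝ, u ⬝ᵥ S *ᵥ v = v ⬝ᵥ S *ᵥ u := by
    intro u v
    rw [dotProduct_mulVec, ← mulVec_transpose, hS, dotProduct_comm]
  set y := S *ᵥ x with hy
  have h2 := h0 (x - L⁻¹ • y)
  have h3 := h1 y
  have h4 := h1 x
  have e1 : x ⬝ᵥ S *ᵥ y = y ⬝ᵥ y := by rw [hsym x y]
  simp only [mulVec_sub, mulVec_smul, sub_dotProduct, dotProduct_sub, smul_dotProduct,
    dotProduct_smul, smul_eq_mul, e1, ← hy] at h2
  have h5 : L * (L⁻¹ * (L⁻¹ * (y ⬝ᵥ S *ᵥ y))) ≤ y ⬝ᵥ y := by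
    have : L * (L⁻¹ * (L⁻¹ * (y ⬝ᵥ S *ᵥ y))) = L⁻¹ * (y ⬝ᵥ S *ᵥ y) := by field_simp
    rw [this, inv_mul_le_iff₀ hL]; exact h3
  have h6 := mul_nonneg hL.le h2
  have h7 : L * (L⁻¹ * (y ⬝ᵥ y)) = y ⬝ᵥ y := by field_simp
  have h8 : y ⬝ᵥ y ≤ L * (x ⬝ᵥ y) := by nlinarith
  have h9 : L * (x ⬝ᵥ y) ≤ L * (L * (x ⬝ᵥ x)) := mul_le_mul_of_nonneg_left h4 hL.le
  nlinarith

lemma orth_dot {m r : ℕ} (V : Matrix (Fin m) (Fin r) ℝ) (h : Vᵀ * V = 1) (c d : Fin r → ℝ) :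
    (V *ᵥ c) ⬝ᵥ (V *ᵥ d) = c ⬝ᵥ d := by
  rw [dotProduct_mulVec, ← mulVec_transpose, mulVec_mulVec, h, one_mulVec]

lemma bessel {m r : ℕ} (V : Matrix (Fin m) (Fin r) ℝ) (h : Vᵀ * V = 1) (x : Fin m → ℝ) :
    (Vᵀ *ᵥ x) ⬝ᵥ (Vᵀ *ᵥ x) ≤ x ⬝ᵥ x := by
  have h0 := dot_self_nonneg (x - V *ᵥ (Vᵀ *ᵥ x))
  have e : x ⬝ᵥ V *ᵥ (Vᵀ *ᵥ x) = (Vᵀ *ᵥ x) ⬝ᵥ (Vᵀ *ᵥ x) := by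
    rw [dotProduct_mulVec, ← mulVec_transpose]
  simp only [sub_dotProduct, dotProduct_sub, orth_dot V h, dotProduct_comm _ x, e] at h0
  linarith

lemma sandwich_dot {m r : ℕ} (V : Matrix (Fin m) (Fin r) ℝ) (a : Fin r → ℝ) (x y : Fin m → ℝ) :
    x ⬝ᵥ (V * diagonal a * Vᵀ) *ᵥ y = ∑ k, a k * ((Vᵀ *ᵥ x) k * (Vᵀ *ᵥ y) k) := by
  rw [← mulVec_mulVec, ← mulVec_mulVec, dotProduct_mulVec, ← mulVec_transpose]
  simp only [dotProduct, mulVec_diagonal]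
  exact Finset.sum_congr rfl fun k _ => by ring

lemma dimcount {r : ℕ} (M : Matrix (Fin r) (Fin r) ℝ) (j : Fin r) :
    ∃ c : Fin r → ℝ, c ≠ 0 ∧ (∀ i, j < i → c i = 0) ∧ ∀ k, k < j → (M *ᵥ c) k = 0 := by
  let M' : Matrix (Fin r) (Fin r) ℝ := fun k i =>
    if k < j then M k i else if k = j then 0 else (1 : Matrix (Fin r) (Fin r) ℝ) k i
  have hdet : M'.det = 0 := Matrix.det_eq_zero_of_row_eq_zero j (by intro i; simp [M'])
  obtain ⟨c, hc, hc0⟩ := Matrix.exists_mulVec_eq_zero_iff.2 hdet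
  refine ⟨c, hc, ?_, ?_⟩
  · intro i hi
    have h := congrFun hc0 i
    have h' : M' i = (1 : Matrix (Fin r) (Fin r) ℝ) i := by
      funext l; simp [M', hi.not_gt, hi.ne']
    have : (M' *ᵥ c) i = ((1 : Matrix (Fin r) (Fin r) ℝ) *ᵥ c) i := by simp only [mulVec, h']
    rw [this, one_mulVec] at h
    simpa using h
  · intro k hk
    have h := congrFun hc0 k
    have h' : M' k = M k := by
      funext l; simp [M', hk]
    simpa only [mulVec, h', Pi.zero_apply] using h

lemma quad_le_of_eigen {m : ℕ} (S : Matrix (Fin m) (Fin m) ℝ) (hS : Sᵀ = S) (c : ℝ)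
    (h : ∀ (ν : ℝ) (x : Fin m → ℝ), x ≠ 0 → S *ᵥ x = ν • x → ν ≤ c) (x : Fin m → ℝ) :
    x ⬝ᵥ S *ᵥ x ≤ c * (x ⬝ᵥ x) := by
  have hH : (c • (1 : Matrix (Fin m) (Fin m) ℝ) - S).IsHermitian := by
    simp [Matrix.IsHermitian, Matrix.conjTranspose_eq_transpose_of_trivial, hS]
  have hpsd : (c • (1 : Matrix (Fin m) (Fin m) ℝ) - S).PosSemidef := by
    rw [hH.posSemidef_iff_eigenvalues_nonneg]
    intro i
    have h1 := hH.mulVec_eigenvectorBasis i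
    have hne : (hH.eigenvectorBasis i : EuclideanSpace ℝ (Fin m)) ≠ 0 :=
      hH.eigenvectorBasis.orthonormal.ne_zero i
    have hne' : (hH.eigenvectorBasis i).ofLp ≠ 0 := by
      intro h0; apply hne; ext k; exact congrFun h0 k
    have := h (c - hH.eigenvalues i) _ hne' (by
      rw [sub_mulVec, smul_mulVec, one_mulVec] at h1
      rw [sub_smul, ← h1]; abel)
    simp; linarith
  have := hpsd.dotProduct_mulVec_nonneg x
  simp [sub_mulVec, smul_mulVec, dotProduct_sub] at this
  linarith

lemma eig_upper {m r : ℕ} (G : Matrix (Fin m) (Fin m) ℝ) (hG : Gᵀ = G)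
    (hG0 : ∀ x, 0 ≤ x ⬝ᵥ G *ᵥ x)
    (Vh : Matrix (Fin m) (Fin r) ℝ) (g : Fin r → ℝ) (hVh : Vhᵀ * Vh = 1)
    (hE : G * Vh = Vh * diagonal g) (hg : Antitone g)
    (hTop : ∀ (ν : ℝ) (x : Fin m → ℝ), x ≠ 0 → G *ᵥ x = ν • x → Vhᵀ *ᵥ x = 0 → ∀ j, ν ≤ g j)
    (j : Fin r) (x : Fin m → ℝ) (hx : ∀ k, k < j → (Vhᵀ *ᵥ x) k = 0) :
    x ⬝ᵥ G *ᵥ x ≤ g j * (x ⬝ᵥ x) := by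
  have hE' : Vhᵀ * G = diagonal g * Vhᵀ := by
    have := congrArg Matrix.transpose hE
    simpa [Matrix.transpose_mul, hG] using this
  have hgj : 0 ≤ g j := by
    have h1 := hG0 (Vh *ᵥ Pi.single j 1)
    rw [mulVec_mulVec, hE, ← mulVec_mulVec, orth_dot Vh hVh] at h1
    simpa [mulVec_diagonal] using h1
  let d : Fin r → ℝ := fun k => if k < j then g k else 0
  have key := quad_le_of_eigen (G - Vh * diagonal d * Vhᵀ)
    (by simp [Matrix.transpose_mul, hG, Matrix.mul_assoc]) (g j) ?_ x
  · rw [sub_mulVec, dotProduct_sub, sandwich_dot] at key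
    have : ∑ k, d k * ((Vhᵀ *ᵥ x) k * (Vhᵀ *ᵥ x) k) = 0 := by
      apply Finset.sum_eq_zero
      intro k _
      by_cases hk : k < j
      · simp [hx k hk]
      · simp [d, hk]
    linarith
  · intro ν w hw hν
    by_cases hν0 : ν = 0
    · rw [hν0]; exact hgj
    have h2 : ∀ k, (g k - d k) * (Vhᵀ *ᵥ w) k = ν * (Vhᵀ *ᵥ w) k := by
      intro k
      have e : Vhᵀ * (G - Vh * diagonal d * Vhᵀ) = diagonal g * Vhᵀ - diagonal d * Vhᵀ := by
        rw [Matrix.mul_sub, hE', ← Matrix.mul_assoc, ← Matrix.mul_assoc, hVh, Matrix.one_mul]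
      have h3 : (Vhᵀ *ᵥ ((G - Vh * diagonal d * Vhᵀ) *ᵥ w)) k = (Vhᵀ *ᵥ (ν • w)) k := by rw [hν]
      rw [mulVec_mulVec, e, sub_mulVec, ← mulVec_mulVec, ← mulVec_mulVec, mulVec_smul] at h3
      simp only [Pi.sub_apply, mulVec_diagonal, Pi.smul_apply, smul_eq_mul] at h3
      linarith
    by_cases h4 : ∃ k, j ≤ k ∧ (Vhᵀ *ᵥ w) k ≠ 0
    · obtain ⟨k, hk, hne⟩ := h4
      have h5 := mul_right_cancel₀ hne (h2 k)
      simp only [d, hk.not_gt, if_false, sub_zero] at h5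
      rw [← h5]; exact hg hk
    · push Not at h4
      have h6 : Vhᵀ *ᵥ w = 0 := by
        funext k
        by_cases hk : j ≤ k
        · exact h4 k hk
        · have := h2 k
          simp only [d, not_le.1 hk, if_true, sub_self, zero_mul] at this
          simpa [hν0] using this.symm
      refine hTop ν w hw ?_ h6 j
      rw [← hν, sub_mulVec, ← mulVec_mulVec, h6]
      simp

lemma pca_perturb {m r : ℕ} (G : Matrix (Fin m) (Fin m) ℝ) (hG : Gᵀ = G)
    (hG0 : ∀ x, 0 ≤ x ⬝ᵥ G *ᵥ x)
    (Vh : Matrix (Fin m) (Fin r) ℝ) (g : Fin r → ℝ) (hVh : Vhᵀ * Vh = 1)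
    (hE : G * Vh = Vh * diagonal g) (hg : Antitone g)
    (hTop : ∀ (ν : ℝ) (x : Fin m → ℝ), x ≠ 0 → G *ᵥ x = ν • x → Vhᵀ *ᵥ x = 0 → ∀ j, ν ≤ g j)
    (V : Matrix (Fin m) (Fin r) ℝ) (a : Fin r → ℝ) (hV : Vᵀ * V = 1)
    (ha : Antitone a) (δ b : ℝ) (hδ : 0 < δ) (hb : 0 ≤ b) (hbδ : 2 * b ≤ δ)
    (haδ : ∀ j, δ ≤ a j) (hgap : ∀ j k, j ≠ k → δ ≤ |a j - a k|)
    (hB : ∀ x, ((G - V * diagonal a * Vᵀ) *ᵥ x) ⬝ᵥ ((G - V * diagonal a * Vᵀ) *ᵥ x)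
      ≤ b ^ 2 * (x ⬝ᵥ x)) :
    (∀ j, |g j - a j| ≤ b) ∧
    ∀ j, ∑ i, (Vh i j - (if 0 ≤ (Vᵀ * Vh) j j then 1 else -1) * V i j) ^ 2 ≤ 8 * b ^ 2 / δ ^ 2 := by
  have hq : ∀ x, |x ⬝ᵥ G *ᵥ x - x ⬝ᵥ (V * diagonal a * Vᵀ) *ᵥ x| ≤ b * (x ⬝ᵥ x) := by
    intro x
    rw [← dotProduct_sub, ← sub_mulVec]
    exact dot_le_of_sq _ _ b _ hb le_rfl (hB x)
  have hweyl : ∀ j, |g j - a j| ≤ b := by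
    intro j
    rw [abs_le]
    constructor
    · obtain ⟨c, hc, hc1, hc2⟩ := dimcount (Vhᵀ * V) j
      have hpos : 0 < c ⬝ᵥ c := lt_of_le_of_ne (dot_self_nonneg c)
        (fun h => hc (dotProduct_self_eq_zero.1 h.symm))
      have h1 := eig_upper G hG hG0 Vh g hVh hE hg hTop j (V *ᵥ c) (by
        intro k hk; rw [mulVec_mulVec]; exact hc2 k hk)
      have h2 := (abs_le.1 (hq (V *ᵥ c))).1
      rw [orth_dot V hV] at h1 h2
      have h2' : Vᵀ *ᵥ (V *ᵥ c) = c := by rw [mulVec_mulVec, hV, one_mulVec]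
      rw [sandwich_dot, h2'] at h2
      have h3 : a j * (c ⬝ᵥ c) ≤ ∑ k, a k * (c k * c k) := by
        rw [dotProduct, Finset.mul_sum]
        apply Finset.sum_le_sum
        intro k _
        by_cases hk : j < k
        · simp [hc1 k hk]
        · exact mul_le_mul_of_nonneg_right (ha (not_lt.1 hk)) (mul_self_nonneg _)
      by_contra hcon
      push Not at hcon
      nlinarith
    · obtain ⟨c, hc, hc1, hc2⟩ := dimcount (Vᵀ * Vh) j
      have hpos : 0 < c ⬝ᵥ c := lt_of_le_of_ne (dot_self_nonneg c)
        (fun h => hc (dotProduct_self_eq_zero.1 h.symm))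
      have h2 := (abs_le.1 (hq (Vh *ᵥ c))).2
      have h4 : (Vh *ᵥ c) ⬝ᵥ G *ᵥ (Vh *ᵥ c) = ∑ k, g k * (c k * c k) := by
        rw [mulVec_mulVec, hE, ← mulVec_mulVec, orth_dot Vh hVh, dotProduct]
        simp only [mulVec_diagonal]
        exact Finset.sum_congr rfl fun k _ => by ring
      have h3 : g j * (c ⬝ᵥ c) ≤ ∑ k, g k * (c k * c k) := by
        rw [dotProduct, Finset.mul_sum]
        apply Finset.sum_le_sum
        intro k _
        by_cases hk : j < k
        · simp [hc1 k hk]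
        · exact mul_le_mul_of_nonneg_right (hg (not_lt.1 hk)) (mul_self_nonneg _)
      have h5 : (Vh *ᵥ c) ⬝ᵥ (V * diagonal a * Vᵀ) *ᵥ (Vh *ᵥ c) ≤ a j * (c ⬝ᵥ c) := by
        rw [← orth_dot Vh hVh]
        refine le_trans ?_ (mul_le_mul_of_nonneg_left (bessel V hV _) (hδ.le.trans (haδ j)))
        rw [sandwich_dot, dotProduct, Finset.mul_sum]
        apply Finset.sum_le_sum
        intro k _
        by_cases hk : k < j
        · have := hc2 k hk
          rw [← mulVec_mulVec] at this
          simp [this]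
        · exact mul_le_mul_of_nonneg_right (ha (not_lt.1 hk)) (mul_self_nonneg _)
      rw [orth_dot Vh hVh] at h2
      by_contra hcon
      push Not at hcon
      nlinarith
  refine ⟨hweyl, ?_⟩
  intro j
  set v : Fin m → ℝ := Vh *ᵥ Pi.single j 1 with hv
  have hvi : ∀ i, v i = Vh i j := by intro i; simp [hv]
  have hvv : v ⬝ᵥ v = 1 := by rw [hv, orth_dot Vh hVh]; simp
  set α : Fin r → ℝ := Vᵀ *ᵥ v with hα
  have hαj : (Vᵀ * Vh) j j = α j := by rw [hα, hv, mulVec_mulVec]; simp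
  have hGv : G *ᵥ v = g j • v := by
    rw [hv, mulVec_mulVec, hE, ← mulVec_mulVec, ← mulVec_smul]
    congr 1; funext k
    by_cases hk : k = j
    · subst hk; simp [mulVec_diagonal]
    · simp [mulVec_diagonal, hk]
  have hBv := hB v
  -- expand
  have hexp : ((G - V * diagonal a * Vᵀ) *ᵥ v) ⬝ᵥ ((G - V * diagonal a * Vᵀ) *ᵥ v)
      = g j ^ 2 - 2 * g j * (∑ k, a k * (α k * α k)) + ∑ k, a k ^ 2 * (α k * α k) := by
    have e1 : (G - V * diagonal a * Vᵀ) *ᵥ v = g j • v - (V * diagonal a * Vᵀ) *ᵥ v := by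
      rw [sub_mulVec, hGv]
    have e2 : ((V * diagonal a * Vᵀ) *ᵥ v) ⬝ᵥ ((V * diagonal a * Vᵀ) *ᵥ v)
        = ∑ k, a k ^ 2 * (α k * α k) := by
      rw [← mulVec_mulVec, ← mulVec_mulVec, orth_dot V hV, dotProduct]
      simp only [mulVec_diagonal]
      exact Finset.sum_congr rfl fun k _ => by rw [← hα]; ring
    have e3 := sandwich_dot V a v v
    rw [← hα] at e3
    rw [e1]
    simp only [sub_dotProduct, dotProduct_sub, smul_dotProduct, dotProduct_smul, smul_eq_mul,
      hvv, e2, dotProduct_comm _ v, e3]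
    ring
  have hbes : α ⬝ᵥ α ≤ 1 := by rw [← hvv]; exact bessel V hV v
  rw [hexp, hvv] at hBv
  have hgj : δ / 2 ≤ g j := by
    have := (abs_le.1 (hweyl j)).1; have := haδ j; linarith
  have hgj2 : (δ / 2) ^ 2 ≤ g j ^ 2 := pow_le_pow_left₀ (by positivity) hgj 2
  have hterm : ∀ k, (δ / 2) ^ 2 * (if k = j then 0 else α k * α k)
      ≤ (g j - a k) ^ 2 * (α k * α k) := by
    intro k
    by_cases hk : k = j
    · simp only [hk, if_true, mul_zero]
      exact mul_nonneg (sq_nonneg _) (mul_self_nonneg _)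
    · simp only [hk, if_false]
      apply mul_le_mul_of_nonneg_right _ (mul_self_nonneg _)
      have h1 := hgap j k (Ne.symm hk)
      have h2 := hweyl j
      have h3 : δ / 2 ≤ |g j - a k| := by
        have := abs_sub_abs_le_abs_sub (a j - a k) (a j - g j)
        rw [abs_sub_comm (a j) (g j)] at this
        have e : a j - a k - (a j - g j) = g j - a k := by ring
        rw [e] at this; linarith
      rw [← sq_abs (g j - a k)]
      exact pow_le_pow_left₀ (by positivity) h3 2
  have hsum := Finset.sum_le_sum (s := Finset.univ) fun k _ => hterm k
  rw [← Finset.mul_sum] at hsum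
  have e4 : ∑ k, (if k = j then 0 else α k * α k) = α ⬝ᵥ α - α j * α j := by
    have : ∀ k, (if k = j then 0 else α k * α k) = α k * α k - (if k = j then α k * α k else 0) := by
      intro k; split_ifs <;> simp
    simp only [this, Finset.sum_sub_distrib, dotProduct]
    simp
  have e5 : ∑ k, (g j - a k) ^ 2 * (α k * α k) = g j ^ 2 * (α ⬝ᵥ α)
      - 2 * g j * (∑ k, a k * (α k * α k)) + ∑ k, a k ^ 2 * (α k * α k) := by
    simp only [dotProduct, Finset.mul_sum, ← Finset.sum_sub_distrib, ← Finset.sum_add_distrib]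
    exact Finset.sum_congr rfl fun k _ => by ring
  rw [e4, e5] at hsum
  have hmain : (δ / 2) ^ 2 * (1 - α j * α j) ≤ b ^ 2 := by nlinarith
  have hαj1 : |α j| ≤ 1 := by
    apply abs_le_of_sq_le_sq _ zero_le_one
    have : α j * α j ≤ α ⬝ᵥ α :=
      Finset.single_le_sum (f := fun k => α k * α k) (fun k _ => mul_self_nonneg _) (Finset.mem_univ j)
    nlinarith
  rw [hαj]
  have hs : ∀ s : ℝ, s * s = 1 → s * α j = |α j| →
      ∑ i, (Vh i j - s * V i j) ^ 2 ≤ 8 * b ^ 2 / δ ^ 2 := by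
    intro s hs1 hs2
    have e6 : ∑ i, (Vh i j - s * V i j) ^ 2
        = (v - V *ᵥ (s • Pi.single j 1)) ⬝ᵥ (v - V *ᵥ (s • Pi.single j 1)) := by
      rw [dotProduct]
      apply Finset.sum_congr rfl
      intro i _
      rw [Pi.sub_apply, hvi, mulVec_smul]
      simp; ring
    have e7 : v ⬝ᵥ V *ᵥ (s • Pi.single j 1) = |α j| := by
      rw [dotProduct_mulVec, ← mulVec_transpose, ← hα, ← hs2]
      simp [mul_comm]
    rw [e6]
    simp only [sub_dotProduct, dotProduct_sub, dotProduct_comm _ v, e7, hvv, orth_dot V hV]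
    have e8 : (s • Pi.single j 1 : Fin r → ℝ) ⬝ᵥ (s • Pi.single j 1) = 1 := by simp [hs1]
    rw [e8, le_div_iff₀ (by positivity)]
    have e9 : α j * α j = |α j| * |α j| := (abs_mul_abs_self _).symm
    have h0 := abs_nonneg (α j)
    have h10 : 1 - |α j| ≤ 1 - α j * α j := by rw [e9]; nlinarith
    have := mul_le_mul_of_nonneg_left h10 (sq_nonneg δ)
    nlinarith
  by_cases h0 : 0 ≤ α j
  · rw [if_pos h0]; exact hs 1 (by norm_num) (by rw [abs_of_nonneg h0, one_mul])
  · rw [if_neg h0]; exact hs (-1) (by norm_num) (by rw [abs_of_neg (not_le.1 h0)]; ring)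

lemma sqrt_diff_bound {a g δ β M : ℝ} (hδ : 0 < δ) (hM : 0 < M) 
    (ha : δ * M ≤ a) (hg : 0 ≤ g) (h : |g - a| ≤ β * M) :
    |Real.sqrt g - Real.sqrt a| ≤ β * Real.sqrt M / Real.sqrt δ := by
  have ha0 : 0 ≤ a := le_trans (by positivity) ha
  have hsa : Real.sqrt δ * Real.sqrt M ≤ Real.sqrt a := by
    rw [← Real.sqrt_mul hδ.le]; exact Real.sqrt_le_sqrt ha
  have hsδ := Real.sqrt_pos.2 hδ
  have hsM := Real.sqrt_pos.2 hM
  have e : g - a = (Real.sqrt g - Real.sqrt a) * (Real.sqrt g + Real.sqrt a) := by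
    have h1 := Real.mul_self_sqrt hg
    have h2 := Real.mul_self_sqrt ha0
    nlinarith
  rw [e, abs_mul, abs_of_nonneg (by positivity : 0 ≤ Real.sqrt g + Real.sqrt a)] at h
  have h1 : |Real.sqrt g - Real.sqrt a| * (Real.sqrt δ * Real.sqrt M) ≤ β * M :=
    le_trans (mul_le_mul_of_nonneg_left (by linarith [Real.sqrt_nonneg g]) (abs_nonneg _)) h
  rw [le_div_iff₀ hsδ]
  have h2 : β * M = β * Real.sqrt M * Real.sqrt M := by
    rw [mul_assoc, Real.mul_self_sqrt hM.le]
  rw [h2] at h1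
  refine le_of_mul_le_mul_right ?_ hsM
  linarith

lemma det_bounds (r : ℕ) (δ A : ℝ) (hδ : 0 < δ) (hA : 0 < A) :
    ∃ C : ℝ, 0 < C ∧ ∀ (m n : ℕ) (M : ℝ) (V Vh : Matrix (Fin m) (Fin r) ℝ) (a g s : Fin r → ℝ)
      (β : ℝ), 0 < M → Vᵀ * V = 1 → (∀ j, |s j| = 1) → 0 ≤ β → 2 * β ≤ δ →
      (∀ j, δ * M ≤ a j) → (∀ j, a j ≤ A * M) → (∀ j, |g j - a j| ≤ β * M) →
      (∀ j, ∑ i, (Vh i j - s j * V i j) ^ 2 ≤ 8 * β ^ 2 / δ ^ 2) →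
      frobNorm (Vh * diagonal (fun j => Real.sqrt (g j))
        - V * diagonal (fun j => Real.sqrt (a j)) * diagonal s) ≤ Real.sqrt M * (C * β) ∧
      ∀ (F : Matrix (Fin r) (Fin n × Fin n) ℝ) (E : Matrix (Fin m) (Fin n × Fin n) ℝ),
        frobNorm (diagonal (fun j => (Real.sqrt (g j))⁻¹) * Vhᵀ
          * (V * diagonal (fun j => Real.sqrt (a j)) * F + E) - diagonal s * F)
        ≤ C * (β * frobNorm F + (Real.sqrt M)⁻¹ * (β * frobNorm E + frobNorm (Vᵀ * E))) := by
  set q := Real.sqrt r with hq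
  have hq0 : 0 ≤ q := Real.sqrt_nonneg _
  set c1 := q * (3 / δ) with hc1
  have hc10 : 0 ≤ c1 := by positivity
  set C1 := c1 * (q * Real.sqrt (A + δ)) + q * (q * (1 / Real.sqrt δ)) with hC1
  set i0 := q * (Real.sqrt (δ / 2))⁻¹ with hi0
  set C2 := i0 * (c1 * (q * (q * Real.sqrt A)) + q * (1 / Real.sqrt δ)) with hC2
  set C3 := i0 * (c1 + q) with hC3
  have hC10 : 0 ≤ C1 := by positivity
  have hi00 : 0 ≤ i0 := by positivity
  have hC20 : 0 ≤ C2 := by positivity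
  have hC30 : 0 ≤ C3 := by positivity
  refine ⟨C1 + C2 + C3 + 1, by positivity, ?_⟩
  intro m n M V Vh a g s β hM hV hs hβ hβδ haδ haA hga hcol
  have hsM := Real.sqrt_pos.2 hM
  have hgl : ∀ j, δ / 2 * M ≤ g j := by
    intro j
    have := (abs_le.1 (hga j)).1; have := haδ j
    nlinarith
  have hg0 : ∀ j, 0 ≤ g j := fun j => le_trans (by positivity) (hgl j)
  have hgu : ∀ j, g j ≤ (A + δ) * M := by
    intro j
    have := (abs_le.1 (hga j)).2; have := haA j
    nlinarith
  have hsd : ∀ j, |Real.sqrt (g j) - Real.sqrt (a j)| ≤ β * Real.sqrt M / Real.sqrt δ :=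
    fun j => sqrt_diff_bound hδ hM (haδ j) (hg0 j) (hga j)
  set D : Matrix (Fin m) (Fin r) ℝ := Vh - V * diagonal s with hD
  have hVh : Vh = D + V * diagonal s := by rw [hD]; abel
  have hDn : frobNorm D ≤ c1 * β := by
    apply le_of_sq_le_sq _ (by positivity)
    rw [frobNorm_sq, Finset.sum_comm]
    calc ∑ j, ∑ i, D i j ^ 2 ≤ ∑ _j : Fin r, 8 * β ^ 2 / δ ^ 2 := by
          apply Finset.sum_le_sum
          intro j _
          refine le_trans (le_of_eq ?_) (hcol j)
          apply Finset.sum_congr rfl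
          intro i _
          rw [hD, Matrix.sub_apply, mul_diagonal, mul_comm (s j)]
      _ = r * (8 * β ^ 2 / δ ^ 2) := by simp
      _ ≤ r * (9 * β ^ 2 / δ ^ 2) := by gcongr; norm_num
      _ = (c1 * β) ^ 2 := by
          rw [hc1, mul_pow, mul_pow, hq, Real.sq_sqrt (by positivity), div_pow]; ring
  have hVn : frobNorm V = q := frobNorm_orth V hV
  have hdd : ∀ t : Fin r → ℝ, (∀ j, |t j| ≤ |Real.sqrt (g j) - Real.sqrt (a j)|) →
      frobNorm (diagonal t) ≤ q * (β * Real.sqrt M / Real.sqrt δ) :=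
    fun t ht => frobNorm_diag_le _ _ (by positivity) fun j => (ht j).trans (hsd j)
  have hC1le : C1 ≤ C1 + C2 + C3 + 1 := by linarith
  have hC2le : C2 ≤ C1 + C2 + C3 + 1 := by linarith
  have hC3le : C3 ≤ C1 + C2 + C3 + 1 := by linarith
  constructor
  · have e : Vh * diagonal (fun j => Real.sqrt (g j))
        - V * diagonal (fun j => Real.sqrt (a j)) * diagonal s
        = D * diagonal (fun j => Real.sqrt (g j))
          + V * diagonal (fun j => s j * (Real.sqrt (g j) - Real.sqrt (a j))) := by
      rw [hD, Matrix.mul_assoc V, diagonal_mul_diagonal, Matrix.sub_mul, Matrix.mul_assoc V,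
        diagonal_mul_diagonal]
      ext i j
      simp only [Matrix.sub_apply, Matrix.add_apply, mul_diagonal]
      ring
    rw [e]
    have h1 : frobNorm (diagonal (fun j => Real.sqrt (g j))) ≤ q * Real.sqrt ((A + δ) * M) :=
      frobNorm_diag_le _ _ (by positivity) fun j => by
        rw [abs_of_nonneg (Real.sqrt_nonneg _)]; exact Real.sqrt_le_sqrt (hgu j)
    have h2 := hdd (fun j => s j * (Real.sqrt (g j) - Real.sqrt (a j))) (fun j => by
      rw [abs_mul, hs j, one_mul])
    rw [Real.sqrt_mul (by positivity)] at h1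
    calc _ ≤ _ := frobNorm_add_le _ _
      _ ≤ frobNorm D * frobNorm (diagonal (fun j => Real.sqrt (g j)))
          + frobNorm V * frobNorm (diagonal (fun j => s j * (Real.sqrt (g j) - Real.sqrt (a j)))) :=
          add_le_add (frobNorm_mul_le _ _) (frobNorm_mul_le _ _)
      _ ≤ (c1 * β) * (q * (Real.sqrt (A + δ) * Real.sqrt M))
          + q * (q * (β * Real.sqrt M / Real.sqrt δ)) := by
          rw [hVn]
          refine add_le_add (mul_le_mul hDn h1 (frobNorm_nonneg _) (by positivity)) ?_
          exact mul_le_mul_of_nonneg_left h2 hq0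
      _ = Real.sqrt M * (C1 * β) := by rw [hC1]; ring
      _ ≤ _ := by gcongr
  · intro F E
    set I := diagonal (fun j => (Real.sqrt (g j))⁻¹) with hI
    have hIn : frobNorm I ≤ i0 * (Real.sqrt M)⁻¹ := by
      rw [hi0, mul_assoc, ← mul_inv, ← Real.sqrt_mul (by positivity)]
      apply frobNorm_diag_le _ _ (by positivity)
      intro j
      rw [abs_of_nonneg (by positivity)]
      exact inv_anti₀ (Real.sqrt_pos.2 (by positivity)) (Real.sqrt_le_sqrt (hgl j))
    have hIg : I * diagonal (fun j => Real.sqrt (g j)) = 1 := by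
      rw [hI, diagonal_mul_diagonal, ← diagonal_one]
      congr 1; funext j
      have : 0 < g j := lt_of_lt_of_le (by positivity) (hgl j)
      exact inv_mul_cancel₀ (Real.sqrt_pos.2 this).ne'
    set Y := V * diagonal (fun j => Real.sqrt (a j)) with hY
    set Z := diagonal (fun j => s j * (Real.sqrt (a j) - Real.sqrt (g j))) with hZ
    have hsT : (diagonal s)ᵀ = diagonal s := diagonal_transpose s
    have eZ : diagonal s * (Vᵀ * Y) = Z + diagonal (fun j => Real.sqrt (g j)) * diagonal s := by
      rw [hY, ← Matrix.mul_assoc Vᵀ, hV, Matrix.one_mul, hZ, diagonal_mul_diagonal,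
        diagonal_mul_diagonal, diagonal_add]
      congr 1; funext j; ring
    have e : I * Vhᵀ * (Y * F + E) - diagonal s * F
        = I * (Dᵀ * Y + Z) * F + I * (Dᵀ * E + diagonal s * (Vᵀ * E)) := by
      have e1 : Vhᵀ = Dᵀ + diagonal s * Vᵀ := by
        rw [hVh, transpose_add, transpose_mul, hsT]
      have e2 : I * Vhᵀ * Y = I * (Dᵀ * Y + Z) + diagonal s := by
        rw [e1, Matrix.mul_assoc, Matrix.add_mul, Matrix.mul_assoc (diagonal s), eZ, ← add_assoc,
          Matrix.mul_add, ← Matrix.mul_assoc I (diagonal _) (diagonal s), hIg, Matrix.one_mul]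
      rw [Matrix.mul_add, ← Matrix.mul_assoc, e2, Matrix.add_mul, e1, Matrix.mul_assoc I _ E,
        Matrix.add_mul, Matrix.mul_assoc (diagonal s)]
      abel
    rw [e]
    have h1 : frobNorm (diagonal (fun j => Real.sqrt (a j))) ≤ q * Real.sqrt (A * M) :=
      frobNorm_diag_le _ _ (by positivity) fun j => by
        rw [abs_of_nonneg (Real.sqrt_nonneg _)]; exact Real.sqrt_le_sqrt (haA j)
    rw [Real.sqrt_mul (by positivity)] at h1
    have hYn : frobNorm Y ≤ q * (q * (Real.sqrt A * Real.sqrt M)) := by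
      refine (frobNorm_mul_le _ _).trans ?_
      rw [hVn]; exact mul_le_mul_of_nonneg_left h1 hq0
    have hZn : frobNorm Z ≤ q * (β * Real.sqrt M / Real.sqrt δ) := hdd _ fun j => by
      rw [abs_mul, hs j, one_mul, abs_sub_comm]
    have hDT : frobNorm Dᵀ ≤ c1 * β := by rw [frobNorm_transpose]; exact hDn
    have hsn : frobNorm (diagonal s) ≤ q := by
      have := frobNorm_diag_le s 1 zero_le_one (fun j => (hs j).le)
      simpa using this
    have hF0 := frobNorm_nonneg F
    have hE0 := frobNorm_nonneg E
    have hVE0 := frobNorm_nonneg (Vᵀ * E)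
    have hb1 : frobNorm (Dᵀ * Y + Z) ≤ (c1 * β) * (q * (q * (Real.sqrt A * Real.sqrt M)))
        + q * (β * Real.sqrt M / Real.sqrt δ) := by
      refine (frobNorm_add_le _ _).trans (add_le_add ?_ hZn)
      exact (frobNorm_mul_le _ _).trans (mul_le_mul hDT hYn (frobNorm_nonneg _) (by positivity))
    have hb2 : frobNorm (Dᵀ * E + diagonal s * (Vᵀ * E))
        ≤ (c1 * β) * frobNorm E + q * frobNorm (Vᵀ * E) := by
      refine (frobNorm_add_le _ _).trans (add_le_add ?_ ?_)
      · exact (frobNorm_mul_le _ _).trans (mul_le_mul_of_nonneg_right hDT hE0)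
      · exact (frobNorm_mul_le _ _).trans (mul_le_mul_of_nonneg_right hsn hVE0)
    calc _ ≤ _ := frobNorm_add_le _ _
      _ ≤ (i0 * (Real.sqrt M)⁻¹) * ((c1 * β) * (q * (q * (Real.sqrt A * Real.sqrt M)))
            + q * (β * Real.sqrt M / Real.sqrt δ)) * frobNorm F
          + (i0 * (Real.sqrt M)⁻¹) * ((c1 * β) * frobNorm E + q * frobNorm (Vᵀ * E)) := by
          refine add_le_add ?_ ?_
          · refine (frobNorm_mul_le _ _).trans (mul_le_mul_of_nonneg_right ?_ hF0)
            exact (frobNorm_mul_le _ _).trans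
              (mul_le_mul hIn hb1 (frobNorm_nonneg _) (by positivity))
          · exact (frobNorm_mul_le _ _).trans
              (mul_le_mul hIn hb2 (frobNorm_nonneg _) (by positivity))
      _ = C2 * (β * frobNorm F) + (Real.sqrt M)⁻¹ * (i0 * (c1 * (β * frobNorm E)
            + q * frobNorm (Vᵀ * E))) := by
          rw [hC2]; field_simp
      _ ≤ C2 * (β * frobNorm F) + (Real.sqrt M)⁻¹ * (i0 * ((c1 + q) * (β * frobNorm E)
            + (c1 + q) * frobNorm (Vᵀ * E))) := by
          gcongr <;> linarith
      _ = C2 * (β * frobNorm F)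
          + C3 * ((Real.sqrt M)⁻¹ * (β * frobNorm E + frobNorm (Vᵀ * E))) := by
          rw [hC3]; ring
      _ ≤ (C1 + C2 + C3 + 1) * (β * frobNorm F) + (C1 + C2 + C3 + 1) *
          ((Real.sqrt M)⁻¹ * (β * frobNorm E + frobNorm (Vᵀ * E))) := by gcongr
      _ = _ := by ring

/-! probability helpers -/

lemma trace_sandwich {k m : ℕ} (Q : Matrix (Fin k) (Fin m) ℝ) (S : Matrix (Fin m) (Fin m) ℝ) :
    (Q * S * Qᵀ).trace = ∑ a, ∑ j, ∑ i, Q a i * Q a j * S i j := by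
  simp only [Matrix.trace, Matrix.diag, Matrix.mul_apply, Matrix.transpose_apply, Finset.sum_mul]
  refine Finset.sum_congr rfl fun a _ => Finset.sum_congr rfl fun j _ =>
    Finset.sum_congr rfl fun i _ => by ring

lemma quad_int {Ω : Type} [MeasurableSpace Ω] (P : Measure Ω) {k m n : ℕ}
    (X : Ω → Matrix (Fin m) (Fin n × Fin n) ℝ) (S : Matrix (Fin m) (Fin m) ℝ)
    (h : ∀ i j, Integrable (fun ω => (X ω * (X ω)ᵀ) i j) P ∧
      ∫ ω, (X ω * (X ω)ᵀ) i j ∂P = S i j) (Q : Matrix (Fin k) (Fin m) ℝ) :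
    Integrable (fun ω => frobNorm (Q * X ω) ^ 2) P ∧
      ∫ ω, frobNorm (Q * X ω) ^ 2 ∂P = (Q * S * Qᵀ).trace := by
  have e : (fun ω => frobNorm (Q * X ω) ^ 2)
      = fun ω => ∑ a, ∑ j, ∑ i, Q a i * Q a j * (X ω * (X ω)ᵀ) i j := by
    funext ω
    rw [frobNorm_sq_trace, transpose_mul, ← Matrix.mul_assoc, Matrix.mul_assoc Q (X ω),
      trace_sandwich]
  have hi : ∀ a j i, Integrable (fun ω => Q a i * Q a j * (X ω * (X ω)ᵀ) i j) P :=
    fun a j i => (h i j).1.const_mul _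
  rw [e]
  constructor
  · exact integrable_finsetSum _ fun a _ => integrable_finsetSum _ fun j _ =>
      integrable_finsetSum _ fun i _ => hi a j i
  · rw [integral_finsetSum _ fun a _ => integrable_finsetSum _ fun j _ =>
      integrable_finsetSum _ fun i _ => hi a j i, trace_sandwich]
    refine Finset.sum_congr rfl fun a _ => ?_
    rw [integral_finsetSum _ fun j _ => integrable_finsetSum _ fun i _ => hi a j i]
    refine Finset.sum_congr rfl fun j _ => ?_
    rw [integral_finsetSum _ fun i _ => hi a j i]
    refine Finset.sum_congr rfl fun i _ => ?_
    rw [integral_const_mul, (h i j).2]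

lemma markov_real {Ω : Type} [MeasurableSpace Ω] (P : Measure Ω) [IsProbabilityMeasure P]
    (f : Ω → ℝ) (hf : Integrable f P) (h0 : ∀ ω, 0 ≤ f ω) (c K : ℝ) (hc : 0 < c) (hK : 0 < K)
    (h : ∫ ω, f ω ∂P ≤ c) : P {ω | K * c < f ω} ≤ ENNReal.ofReal (1 / K) := by
  have h1 := mul_meas_ge_le_integral_of_nonneg (Filter.Eventually.of_forall h0) hf (K * c)
  have h2 : P.real {ω | K * c ≤ f ω} ≤ 1 / K := by
    rw [le_div_iff₀ hK]
    have : K * c * P.real {ω | K * c ≤ f ω} ≤ c := h1.trans h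
    refine le_of_mul_le_mul_right ?_ hc
    linarith
  calc P {ω | K * c < f ω} ≤ P {ω | K * c ≤ f ω} := measure_mono (Set.ofPred_subset_ofPred.2 fun ω h => h.le)
    _ ≤ _ := by
      rw [← ofReal_measureReal]
      exact ENNReal.ofReal_le_ofReal h2

lemma pos_lb {ι : Type} [Finite ι] (f : ι → ℝ) (hf : ∀ i, 0 < f i) :
    ∃ δ : ℝ, 0 < δ ∧ ∀ i, δ ≤ f i := by
  rcases isEmpty_or_nonempty ι with h | h
  · exact ⟨1, one_pos, fun i => h.elim i⟩
  · obtain ⟨i, hi⟩ := Finite.exists_min f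
    exact ⟨f i, hf i, hi⟩

set_option maxHeartbeats 4000000

/-- **Proposition 1.** Consistency (up to sign) of the tensor-PCA estimators of the
loadings `U` and the factors `F_(3)t` in the factor model `W_(3)t = U·F_(3)t + E_(3)t`,
under Assumptions 1–6, as `m, T → ∞`. -/
theorem proposition1
    (N r : ℕ) (hr : 0 < r)
    -- a probability space for each pair (m, T)
    (Ω : ℕ → ℕ → Type) (instΩ : ∀ m T, MeasurableSpace (Ω m T))
    (P : ∀ m T, Measure (Ω m T)) (hP : ∀ m T, IsProbabilityMeasure (P m T))
    -- common and idiosyncratic components of the matricized weight tensor, t = 1,…,T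
    (χ Err W : ∀ m T : ℕ, ℕ → Ω m T → Matrix (Fin m) (Fin N × Fin N) ℝ)
    (hW : ∀ m T t ω, W m T t ω = χ m T t ω + Err m T t ω)
    -- Assumption 1: spectral data of Γ^χ = E[χ_t·χ_tᵀ], factors and loadings
    (V : ∀ m T : ℕ, Matrix (Fin m) (Fin r) ℝ) (μ : ℕ → ℕ → Fin r → ℝ)
    (hVorth : ∀ m T, r ≤ m → (V m T)ᵀ * V m T = 1)
    (hμpos : ∀ m T j, 0 < μ m T j)
    (hμdec : ∀ m T, ∀ j k : Fin r, j < k → μ m T k < μ m T j)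
    (hΓχ : ∀ m T t, 1 ≤ t → t ≤ T → ∀ i j,
      Integrable (fun ω => (χ m T t ω * (χ m T t ω)ᵀ) i j) (P m T) ∧
      ∫ ω, (χ m T t ω * (χ m T t ω)ᵀ) i j ∂(P m T)
        = (V m T * Matrix.diagonal (μ m T) * (V m T)ᵀ) i j)
    (F : ∀ m T : ℕ, ℕ → Ω m T → Matrix (Fin r) (Fin N × Fin N) ℝ)
    (hF : ∀ m T t ω, F m T t ω
      = Matrix.diagonal (fun j => (Real.sqrt (μ m T j))⁻¹) * (V m T)ᵀ * χ m T t ω)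
    (U : ∀ m T : ℕ, Matrix (Fin m) (Fin r) ℝ)
    (hU : ∀ m T, U m T = V m T * Matrix.diagonal (fun j => Real.sqrt (μ m T j)))
    -- Assumption 2: idiosyncratic moments
    (hEmean : ∀ m T t, 1 ≤ t → t ≤ T → ∀ i j,
      Integrable (fun ω => Err m T t ω i j) (P m T) ∧
      ∫ ω, Err m T t ω i j ∂(P m T) = 0)
    (hE4 : ∀ m T t, 1 ≤ t → t ≤ T →
      Integrable (fun ω => (frobNorm (Err m T t ω)) ^ 4) (P m T))
    -- Assumption 3: errors and factors uncorrelated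
    (hEF : ∀ m T t, 1 ≤ t → t ≤ T → ∀ i j,
      Integrable (fun ω => (Err m T t ω * (F m T t ω)ᵀ) i j) (P m T) ∧
      ∫ ω, (Err m T t ω * (F m T t ω)ᵀ) i j ∂(P m T) = 0)
    -- Assumption 4: pervasiveness of the common factors
    (clo cup : Fin r → ℝ)
    (hclo : ∀ j, 0 < clo j)
    (hsep : ∀ j k : Fin r, (j : ℕ) + 1 = (k : ℕ) → cup k < clo j)
    (hperv : ∃ m₀, ∀ m, m₀ ≤ m → ∀ T, ∀ j,
      clo j * m < μ m T j ∧ μ m T j < cup j * m)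
    -- Assumption 5: non-pervasiveness of the idiosyncratic components
    (ΓE : ∀ m T : ℕ, Matrix (Fin m) (Fin m) ℝ) (lam : ℝ)
    (hΓE : ∀ m T t, 1 ≤ t → t ≤ T → ∀ i j,
      Integrable (fun ω => (Err m T t ω * (Err m T t ω)ᵀ) i j) (P m T) ∧
      ∫ ω, (Err m T t ω * (Err m T t ω)ᵀ) i j ∂(P m T) = ΓE m T i j)
    (hlam : ∀ m T, ∀ x : Fin m → ℝ, x ⬝ᵥ (ΓE m T).mulVec x ≤ lam * (x ⬝ᵥ x))
    -- sample covariance Γ̂ = (1/T)·Σ_t W_(3)t·W_(3)tᵀ and population Γ^W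
    (Γhat : ∀ m T : ℕ, Ω m T → Matrix (Fin m) (Fin m) ℝ)
    (hΓhat : ∀ m T ω, Γhat m T ω
      = (T : ℝ)⁻¹ • ∑ t ∈ Finset.Icc 1 T, W m T t ω * (W m T t ω)ᵀ)
    (ΓW : ∀ m T : ℕ, Matrix (Fin m) (Fin m) ℝ)
    (hΓW : ∀ m T t, 1 ≤ t → t ≤ T → ∀ i j,
      Integrable (fun ω => (W m T t ω * (W m T t ω)ᵀ) i j) (P m T) ∧
      ∫ ω, (W m T t ω * (W m T t ω)ᵀ) i j ∂(P m T) = ΓW m T i j)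
    -- Assumption 6: convergence of the sample covariance
    (R : ℝ)
    (hA6 : ∀ m T, 1 ≤ T → ∀ i j,
      Integrable (fun ω => (Γhat m T ω i j - ΓW m T i j) ^ 2) (P m T) ∧
      (T : ℝ) * ∫ ω, (Γhat m T ω i j - ΓW m T i j) ^ 2 ∂(P m T) ≤ R)
    -- estimators: M̂ = diag(μ̂) the r largest eigenvalues of Γ̂, V̂ corresponding
    -- unit-norm eigenvectors, Û = V̂·M̂^{1/2}, F̂_(3)t = M̂^{−1/2}·V̂ᵀ·W_(3)t
    (μhat : ∀ m T : ℕ, Ω m T → Fin r → ℝ)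
    (Vhat : ∀ m T : ℕ, Ω m T → Matrix (Fin m) (Fin r) ℝ)
    (hVhatOrth : ∀ m T ω, r ≤ m → (Vhat m T ω)ᵀ * Vhat m T ω = 1)
    (hEigen : ∀ m T ω, Γhat m T ω * Vhat m T ω
      = Vhat m T ω * Matrix.diagonal (μhat m T ω))
    (hμhatDec : ∀ m T ω, Antitone (μhat m T ω))
    (hTop : ∀ m T ω (ν : ℝ) (x : Fin m → ℝ), x ≠ 0 →
      (Γhat m T ω).mulVec x = ν • x → (Vhat m T ω)ᵀ.mulVec x = 0 →
      ∀ j, ν ≤ μhat m T ω j)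
    (Uhat : ∀ m T : ℕ, Ω m T → Matrix (Fin m) (Fin r) ℝ)
    (hUhat : ∀ m T ω, Uhat m T ω
      = Vhat m T ω * Matrix.diagonal (fun j => Real.sqrt (μhat m T ω j)))
    (Fhat : ∀ m T : ℕ, ℕ → Ω m T → Matrix (Fin r) (Fin N × Fin N) ℝ)
    (hFhat : ∀ m T t ω, Fhat m T t ω
      = Matrix.diagonal (fun j => (Real.sqrt (μhat m T ω j))⁻¹) * (Vhat m T ω)ᵀ
          * W m T t ω) :
    -- conclusion: there is a sample-dependent diagonal ±1 matrix Ĵ_r such that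
    -- (1/√m)·‖Û − U·Ĵ_r‖_F = O_p(max(1/√T, 1/m)) and, for each t,
    -- ‖F̂_(3)t − Ĵ_r·F_(3)t‖_F = O_p(max(1/√T, 1/√m))
    ∃ J : ∀ m T : ℕ, Ω m T → Matrix (Fin r) (Fin r) ℝ,
      (∀ m T ω, (J m T ω).IsDiag ∧ ∀ j, J m T ω j j = 1 ∨ J m T ω j j = -1) ∧
      (∀ ε : ℝ, 0 < ε → ∃ C : ℝ, 0 < C ∧ ∃ m₀ T₀ : ℕ, ∀ m T : ℕ,
        m₀ ≤ m → T₀ ≤ T →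
        P m T {ω | C * max (Real.sqrt T)⁻¹ ((m : ℝ))⁻¹
            < (Real.sqrt m)⁻¹ * frobNorm (Uhat m T ω - U m T * J m T ω)}
          < ENNReal.ofReal ε) ∧
      (∀ ε : ℝ, 0 < ε → ∃ C : ℝ, 0 < C ∧ ∃ m₀ T₀ : ℕ, ∀ m T : ℕ,
        m₀ ≤ m → T₀ ≤ T → ∀ t, 1 ≤ t → t ≤ T →
        P m T {ω | C * max (Real.sqrt T)⁻¹ (Real.sqrt m)⁻¹
            < frobNorm (Fhat m T t ω - J m T ω * F m T t ω)}
          < ENNReal.ofReal ε) := by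
  classical
  -- constants
  obtain ⟨δ1, hδ1, hδ1'⟩ := pos_lb clo hclo
  obtain ⟨δ2, hδ2, hδ2'⟩ := pos_lb
    (fun p : Fin r × Fin r => if (p.1 : ℕ) + 1 = (p.2 : ℕ) then clo p.1 - cup p.2 else 1) (by
      rintro ⟨j, k⟩
      dsimp only
      split_ifs with h
      · exact sub_pos.2 (hsep j k h)
      · exact one_pos)
  set δ := min δ1 δ2 with hδdef
  have hδ : 0 < δ := lt_min hδ1 hδ2
  have hδclo : ∀ j, δ ≤ clo j := fun j => (min_le_left _ _).trans (hδ1' j)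
  have hδsep : ∀ j k : Fin r, (j : ℕ) + 1 = (k : ℕ) → δ ≤ clo j - cup k := by
    intro j k h
    have h1 := hδ2' (j, k)
    simp only [h, if_true] at h1
    exact (min_le_right δ1 δ2).trans h1
  set A : ℝ := ∑ j, |cup j| + 1 with hAdef
  have hA : 0 < A := by positivity
  have hcupA : ∀ j, cup j ≤ A := by
    intro j
    have h1 : |cup j| ≤ ∑ j, |cup j| :=
      Finset.single_le_sum (f := fun j => |cup j|) (fun k _ => abs_nonneg _) (Finset.mem_univ j)
    have := le_abs_self (cup j)
    linarith
  set L : ℝ := max lam 1 with hLdef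
  have hL : 0 < L := lt_of_lt_of_le one_pos (le_max_right _ _)
  set R' : ℝ := max R 1 with hRdef
  have hR' : 0 < R' := lt_of_lt_of_le one_pos (le_max_right _ _)
  have hrR : (0 : ℝ) < r := by exact_mod_cast hr
  obtain ⟨mp, hmp⟩ := hperv
  obtain ⟨C, hC, hdet⟩ := det_bounds r δ A hδ hA
  -- population facts
  have hlamL : ∀ m T (x : Fin m → ℝ), x ⬝ᵥ (ΓE m T) *ᵥ x ≤ L * (x ⬝ᵥ x) := fun m T x =>
    (hlam m T x).trans (mul_le_mul_of_nonneg_right (le_max_left _ _) (dot_self_nonneg x))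
  have htrE : ∀ m T (k : ℕ) (Q : Matrix (Fin k) (Fin m) ℝ),
      (Q * ΓE m T * Qᵀ).trace ≤ L * frobNorm Q ^ 2 := by
    intro m T k Q
    rw [frobNorm_sq, Finset.mul_sum, Matrix.trace]
    apply Finset.sum_le_sum
    intro a _
    have h1 := hlamL m T (Q a)
    have e1 : (Q * ΓE m T * Qᵀ).diag a = (Q a) ⬝ᵥ (ΓE m T) *ᵥ (Q a) := by
      rw [Matrix.diag_apply, Matrix.mul_assoc]
      rfl
    have e2 : (Q a) ⬝ᵥ (Q a) = ∑ j, Q a j ^ 2 := by simp [dotProduct, sq]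
    rw [e1, ← e2]; exact h1
  have hχUF : ∀ m T t, r ≤ m → 1 ≤ t → t ≤ T →
      ∀ᵐ ω ∂(P m T), χ m T t ω = U m T * F m T t ω := by
    intro m T t hrm ht1 htT
    obtain ⟨hi, he⟩ := quad_int (P m T) (χ m T t) _ (hΓχ m T t ht1 htT)
      (1 - V m T * (V m T)ᵀ)
    have hz : (1 - V m T * (V m T)ᵀ) * (V m T * diagonal (μ m T) * (V m T)ᵀ) = 0 := by
      rw [Matrix.sub_mul, Matrix.one_mul, Matrix.mul_assoc (V m T) (V m T)ᵀ, ← Matrix.mul_assoc (V m T)ᵀ,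
        ← Matrix.mul_assoc (V m T)ᵀ, hVorth m T hrm, Matrix.one_mul, Matrix.mul_assoc, sub_self]
    rw [hz, Matrix.zero_mul, Matrix.trace_zero,
      integral_eq_zero_iff_of_nonneg (fun ω => sq_nonneg _) hi] at he
    filter_upwards [he] with ω hω
    have h0 : frobNorm ((1 - V m T * (V m T)ᵀ) * χ m T t ω) ^ 2 = 0 := hω
    have h1 : (1 - V m T * (V m T)ᵀ) * χ m T t ω = 0 := by
      rw [frobNorm_sq] at h0
      ext i j
      have h2 := (Finset.sum_eq_zero_iff_of_nonneg (fun i _ =>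
        Finset.sum_nonneg fun j _ => sq_nonneg _)).1 h0 i (Finset.mem_univ i)
      have h3 := (Finset.sum_eq_zero_iff_of_nonneg (fun j _ => sq_nonneg _)).1 h2 j
        (Finset.mem_univ j)
      simpa using h3
    have h2 : U m T * F m T t ω = V m T * (V m T)ᵀ * χ m T t ω := by
      rw [hU, hF, Matrix.mul_assoc (V m T), ← Matrix.mul_assoc (diagonal _),
        ← Matrix.mul_assoc (diagonal _), diagonal_mul_diagonal]
      have : (fun i => Real.sqrt (μ m T i) * (Real.sqrt (μ m T i))⁻¹) = fun _ => (1 : ℝ) := by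
        funext i; exact mul_inv_cancel₀ (Real.sqrt_pos.2 (hμpos m T i)).ne'
      rw [this, diagonal_one, Matrix.one_mul, Matrix.mul_assoc]
    rw [h2]
    rw [Matrix.sub_mul, Matrix.one_mul, sub_eq_zero] at h1
    exact h1
  have hΓWeq : ∀ m T, r ≤ m → 1 ≤ T →
      ΓW m T = V m T * diagonal (μ m T) * (V m T)ᵀ + ΓE m T := by
    intro m T hrm hT
    ext i j
    rw [← (hΓW m T 1 le_rfl hT i j).2, Matrix.add_apply, ← (hΓχ m T 1 le_rfl hT i j).2,
      ← (hΓE m T 1 le_rfl hT i j).2]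
    have hcr : ∀ i j, Integrable (fun ω => ∑ l, U m T i l * (Err m T 1 ω * (F m T 1 ω)ᵀ) j l) (P m T)
        ∧ ∫ ω, ∑ l, U m T i l * (Err m T 1 ω * (F m T 1 ω)ᵀ) j l ∂(P m T) = 0 := by
      intro i j
      have hi : ∀ l, Integrable (fun ω => U m T i l * (Err m T 1 ω * (F m T 1 ω)ᵀ) j l) (P m T) :=
        fun l => (hEF m T 1 le_rfl hT j l).1.const_mul _
      refine ⟨integrable_finsetSum _ fun l _ => hi l, ?_⟩
      rw [integral_finsetSum _ fun l _ => hi l]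
      apply Finset.sum_eq_zero
      intro l _
      rw [integral_const_mul, (hEF m T 1 le_rfl hT j l).2, mul_zero]
    have hae : (fun ω => (W m T 1 ω * (W m T 1 ω)ᵀ) i j) =ᵐ[P m T]
        fun ω => (χ m T 1 ω * (χ m T 1 ω)ᵀ) i j + (Err m T 1 ω * (Err m T 1 ω)ᵀ) i j
          + (∑ l, U m T i l * (Err m T 1 ω * (F m T 1 ω)ᵀ) j l
          + ∑ l, U m T j l * (Err m T 1 ω * (F m T 1 ω)ᵀ) i l) := by
      filter_upwards [hχUF m T 1 hrm le_rfl hT] with ω hω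
      have e1 : (χ m T 1 ω * (Err m T 1 ω)ᵀ) i j
          = ∑ l, U m T i l * (Err m T 1 ω * (F m T 1 ω)ᵀ) j l := by
        rw [hω, Matrix.mul_assoc, Matrix.mul_apply]
        refine Finset.sum_congr rfl fun l _ => ?_
        rw [← Matrix.transpose_apply (Err m T 1 ω * _), transpose_mul, transpose_transpose]
      have e2 : (Err m T 1 ω * (χ m T 1 ω)ᵀ) i j
          = ∑ l, U m T j l * (Err m T 1 ω * (F m T 1 ω)ᵀ) i l := by
        rw [hω, transpose_mul, ← Matrix.mul_assoc, Matrix.mul_apply]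
        refine Finset.sum_congr rfl fun l _ => ?_
        rw [Matrix.transpose_apply (U m T), mul_comm]
      rw [hW, transpose_add, Matrix.mul_add, Matrix.add_mul, Matrix.add_mul]
      simp only [Matrix.add_apply, e1, e2]
      ring
    have hi1 := (hΓχ m T 1 le_rfl hT i j).1
    have hi2 := (hΓE m T 1 le_rfl hT i j).1
    have hs1 : Integrable (fun ω => (χ m T 1 ω * (χ m T 1 ω)ᵀ) i j
        + (Err m T 1 ω * (Err m T 1 ω)ᵀ) i j) (P m T) := hi1.add hi2
    have hs2 : Integrable (fun ω => ∑ l, U m T i l * (Err m T 1 ω * (F m T 1 ω)ᵀ) j l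
          + ∑ l, U m T j l * (Err m T 1 ω * (F m T 1 ω)ᵀ) i l) (P m T) :=
      (hcr i j).1.add (hcr j i).1
    rw [integral_congr_ae hae, integral_add hs1 hs2,
      integral_add hi1 hi2, integral_add (hcr i j).1 (hcr j i).1, (hcr i j).2, (hcr j i).2]
    ring
  have hΓEpsd : ∀ m T, 1 ≤ T → ∀ x : Fin m → ℝ, 0 ≤ x ⬝ᵥ (ΓE m T) *ᵥ x := by
    intro m T hT x
    obtain ⟨-, he⟩ := quad_int (P m T) (Err m T 1) _ (hΓE m T 1 le_rfl hT)
      (Matrix.of fun (_ : Fin 1) i => x i)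
    have h0 : 0 ≤ ∫ ω, frobNorm ((Matrix.of fun (_ : Fin 1) i => x i) * Err m T 1 ω) ^ 2 ∂(P m T) :=
      integral_nonneg fun ω => sq_nonneg _
    rw [he] at h0
    refine h0.trans (le_of_eq ?_)
    rw [Matrix.trace, Fin.sum_univ_one, Matrix.diag_apply, Matrix.mul_assoc]
    rfl
  have hΓEsym : ∀ m T, 1 ≤ T → (ΓE m T)ᵀ = ΓE m T := by
    intro m T hT
    ext i j
    rw [Matrix.transpose_apply, ← (hΓE m T 1 le_rfl hT i j).2, ← (hΓE m T 1 le_rfl hT j i).2]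
    congr 1; funext ω
    simp [Matrix.mul_apply, mul_comm]
  -- sample covariance is symmetric PSD
  have hGsym : ∀ m T ω, (Γhat m T ω)ᵀ = Γhat m T ω := by
    intro m T ω
    rw [hΓhat, transpose_smul, transpose_sum]
    simp [transpose_mul]
  have hGpsd : ∀ m T ω (x : Fin m → ℝ), 0 ≤ x ⬝ᵥ (Γhat m T ω) *ᵥ x := by
    intro m T ω x
    rw [hΓhat, smul_mulVec, dotProduct_smul, smul_eq_mul, Matrix.sum_mulVec, dotProduct_sum]
    refine mul_nonneg (by positivity) (Finset.sum_nonneg fun t _ => ?_)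
    rw [← mulVec_mulVec, dotProduct_mulVec, ← mulVec_transpose]
    exact Finset.sum_nonneg fun _ _ => mul_self_nonneg _
  have hJs : ∀ m T ω (j : Fin r), |if 0 ≤ ((V m T)ᵀ * Vhat m T ω) j j then (1 : ℝ) else -1| = 1 := by
    intro m T ω j; split_ifs <;> simp
  -- deterministic core
  have core : ∀ m T ω (b : ℝ), mp ≤ m → r ≤ m → 1 ≤ m → 1 ≤ T → 0 ≤ b →
      frobNorm (Γhat m T ω - ΓW m T) ≤ b * m → 2 * (L / m + b) ≤ δ →
      (∀ j, |μhat m T ω j - μ m T j| ≤ (L / m + b) * m) ∧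
      ∀ j, ∑ i, (Vhat m T ω i j - (if 0 ≤ ((V m T)ᵀ * Vhat m T ω) j j then 1 else -1) * V m T i j) ^ 2
        ≤ 8 * (L / m + b) ^ 2 / δ ^ 2 := by
    intro m T ω b hm1 hrm hm hT hb hDb hsmall
    have hmR : (0 : ℝ) < m := by exact_mod_cast hm
    have hanti : Antitone (μ m T) := by
      intro j k hjk
      rcases hjk.eq_or_lt with h | h
      · rw [h]
      · exact (hμdec m T j k h).le
    have hgap : ∀ j k : Fin r, j < k → δ * m ≤ μ m T j - μ m T k := by
      intro j k hjk
      have hlt : (j : ℕ) + 1 < r := lt_of_le_of_lt (Nat.succ_le_of_lt hjk) k.2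
      have h1 : μ m T k ≤ μ m T ⟨j + 1, hlt⟩ := hanti (Fin.le_def.2 (Nat.succ_le_of_lt hjk))
      have h2 := (hmp m hm1 T ⟨j + 1, hlt⟩).2
      have h3 := (hmp m hm1 T j).1
      have h4 := mul_le_mul_of_nonneg_right (hδsep j ⟨j + 1, hlt⟩ rfl) hmR.le
      nlinarith
    have hB := pca_perturb (Γhat m T ω) (hGsym m T ω) (hGpsd m T ω) (Vhat m T ω) (μhat m T ω)
      (hVhatOrth m T ω hrm) (hEigen m T ω) (hμhatDec m T ω) (hTop m T ω) (V m T) (μ m T)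
      (hVorth m T hrm) hanti (δ * m) ((L / m + b) * m) (by positivity) (by positivity)
      (by nlinarith) (fun j => by
        have h1 := (hmp m hm1 T j).1
        have h2 := mul_le_mul_of_nonneg_right (hδclo j) hmR.le
        linarith) (fun j k hjk => by
        rcases lt_or_gt_of_ne hjk with h | h
        · exact (hgap j k h).trans (le_abs_self _)
        · rw [abs_sub_comm]; exact (hgap k j h).trans (le_abs_self _)) (fun x => by
        have e1 : Γhat m T ω - V m T * diagonal (μ m T) * (V m T)ᵀ
            = ΓE m T + (Γhat m T ω - ΓW m T) := by rw [hΓWeq m T hrm hT]; abel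
        have e2 : (L / m + b) * m = L + b * m := by field_simp
        rw [e1, e2, add_mulVec]
        refine add_dot_bound _ _ L (b * m) _ hL.le (by positivity) (dot_self_nonneg x) ?_ ?_
        · exact psd_mulVec_bound _ (hΓEsym m T hT) L hL (hΓEpsd m T hT) (hlamL m T) x
        · refine (mulVec_frob_bound _ x).trans ?_
          exact mul_le_mul_of_nonneg_right (pow_le_pow_left₀ (frobNorm_nonneg _) hDb 2)
            (dot_self_nonneg x))
    refine ⟨hB.1, fun j => (hB.2 j).trans (le_of_eq ?_)⟩
    field_simp
  have core2 : ∀ m T ω (b : ℝ), mp ≤ m → r ≤ m → 1 ≤ m → 1 ≤ T → 0 ≤ b →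
      frobNorm (Γhat m T ω - ΓW m T) ≤ b * m → 2 * (L / m + b) ≤ δ → _ :=
    fun m T ω b hm1 hrm hm hT hb hDb hsmall =>
      have hmR : (0 : ℝ) < m := by exact_mod_cast hm
      hdet m N m (V m T) (Vhat m T ω) (μ m T) (μhat m T ω)
        (fun j => if 0 ≤ ((V m T)ᵀ * Vhat m T ω) j j then (1 : ℝ) else -1) (L / m + b) hmR
        (hVorth m T hrm) (hJs m T ω) (by positivity) hsmall
        (fun j => (mul_le_mul_of_nonneg_right (hδclo j) hmR.le).trans (hmp m hm1 T j).1.le)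
        (fun j => (hmp m hm1 T j).2.le.trans (mul_le_mul_of_nonneg_right (hcupA j) hmR.le))
        (core m T ω b hm1 hrm hm hT hb hDb hsmall).1
        (core m T ω b hm1 hrm hm hT hb hDb hsmall).2
  -- Markov bound for the sample covariance
  have hmarkD : ∀ m T (K : ℝ), 1 ≤ m → 1 ≤ T → 0 < K →
      P m T {ω | Real.sqrt (K * R') * (Real.sqrt T)⁻¹ * m < frobNorm (Γhat m T ω - ΓW m T)}
        ≤ ENNReal.ofReal (1 / K) := by
    intro m T K hm hT hK
    have hmR : (0 : ℝ) < m := by exact_mod_cast hm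
    have hTR : (0 : ℝ) < T := by exact_mod_cast hT
    have hint : Integrable (fun ω => frobNorm (Γhat m T ω - ΓW m T) ^ 2) (P m T) := by
      simp only [frobNorm_sq, Matrix.sub_apply]
      exact integrable_finsetSum _ fun i _ => integrable_finsetSum _ fun j _ => (hA6 m T hT i j).1
    have hval : ∫ ω, frobNorm (Γhat m T ω - ΓW m T) ^ 2 ∂(P m T) ≤ m ^ 2 * R' / T := by
      simp only [frobNorm_sq, Matrix.sub_apply]
      rw [integral_finsetSum _ fun i _ => integrable_finsetSum _ fun j _ => (hA6 m T hT i j).1]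
      have : ∀ i j, ∫ ω, (Γhat m T ω i j - ΓW m T i j) ^ 2 ∂(P m T) ≤ R' / T := by
        intro i j
        rw [le_div_iff₀ hTR, mul_comm]
        exact (hA6 m T hT i j).2.trans (le_max_left _ _)
      calc _ ≤ ∑ _i : Fin m, ∑ _j : Fin m, R' / T := by
            apply Finset.sum_le_sum
            intro i _
            rw [integral_finsetSum _ fun j _ => (hA6 m T hT i j).1]
            exact Finset.sum_le_sum fun j _ => this i j
        _ = _ := by simp; ring
    have := hP m T
    refine le_trans (measure_mono (Set.ofPred_subset_ofPred.2 fun ω h => ?_))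
      (markov_real (P m T) _ hint (fun ω => sq_nonneg _) _ K (by positivity) hK hval)
    have h2 := pow_lt_pow_left₀ h (by positivity) two_ne_zero
    refine lt_of_le_of_lt (le_of_eq ?_) h2
    rw [mul_pow, mul_pow, Real.sq_sqrt (by positivity), inv_pow, Real.sq_sqrt (by positivity)]
    field_simp
  -- thresholds
  have hthr : ∀ K' : ℝ, 0 ≤ K' → ∃ m₀ T₀ : ℕ, ∀ m T : ℕ, m₀ ≤ m → T₀ ≤ T →
      mp ≤ m ∧ r ≤ m ∧ 1 ≤ m ∧ 1 ≤ T ∧ 2 * (L / m + K' * (Real.sqrt T)⁻¹) ≤ δ := by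
    intro K' hK'
    obtain ⟨n1, hn1⟩ := exists_nat_ge (4 * L / δ)
    obtain ⟨n2, hn2⟩ := exists_nat_ge ((4 * K' / δ) ^ 2)
    refine ⟨mp + r + n1 + 1, n2 + 1, fun m T hm hT => ⟨by omega, by omega, by omega, by omega, ?_⟩⟩
    have hmR : (0 : ℝ) < m := by exact_mod_cast (by omega : 0 < m)
    have hTR : (0 : ℝ) < T := by exact_mod_cast (by omega : 0 < T)
    have h1 : 4 * L / δ ≤ m := hn1.trans (by exact_mod_cast (by omega : n1 ≤ m))
    have h2 : (4 * K' / δ) ^ 2 ≤ T := hn2.trans (by exact_mod_cast (by omega : n2 ≤ T))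
    have h3 : 4 * K' / δ ≤ Real.sqrt T := Real.le_sqrt_of_sq_le h2
    have hsT := Real.sqrt_pos.2 hTR
    have h4 : L / m ≤ δ / 4 := by
      rw [div_le_iff₀ hδ] at h1
      rw [div_le_iff₀ hmR]; linarith
    have h5 : K' * (Real.sqrt T)⁻¹ ≤ δ / 4 := by
      rw [div_le_iff₀ hδ] at h3
      rw [← div_eq_mul_inv, div_le_iff₀ hsT]; linarith
    linarith
  refine ⟨fun m T ω => diagonal (fun j => if 0 ≤ ((V m T)ᵀ * Vhat m T ω) j j then (1 : ℝ) else -1),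
    ?_, ?_, ?_⟩
  · intro m T ω
    refine ⟨Matrix.isDiag_diagonal _, fun j => ?_⟩
    simp only [diagonal_apply_eq]
    split_ifs
    · exact Or.inl rfl
    · exact Or.inr rfl
  · intro ε hε
    set K := 2 / ε with hK
    have hK0 : 0 < K := by positivity
    set K' := Real.sqrt (K * R') with hK'
    have hK'0 : 0 ≤ K' := Real.sqrt_nonneg _
    obtain ⟨m₀, T₀, hmT⟩ := hthr K' hK'0
    refine ⟨C * (L + K'), by positivity, m₀, T₀, fun m T hm hT => ?_⟩
    obtain ⟨hm1, hrm, hm1', hT1, hsmall⟩ := hmT m T hm hT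
    have hmR : (0 : ℝ) < m := by exact_mod_cast hm1'
    have hsm := Real.sqrt_pos.2 hmR
    refine lt_of_le_of_lt (le_trans (measure_mono (Set.ofPred_subset_ofPred.2 fun ω h => ?_))
      (hmarkD m T K hm1' hT1 hK0)) ?_
    · by_contra hcon
      push Not at hcon
      have h1 := (core2 m T ω _ hm1 hrm hm1' hT1 (by positivity) hcon hsmall).1
      rw [hUhat, hU] at h
      have h2 := mul_le_mul_of_nonneg_left h1 (inv_nonneg.2 hsm.le)
      rw [← mul_assoc, inv_mul_cancel₀ hsm.ne', one_mul] at h2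
      have h3 : L / m + K' * (Real.sqrt T)⁻¹ ≤ (L + K') * max (Real.sqrt T)⁻¹ ((m : ℝ))⁻¹ := by
        rw [add_mul, div_eq_mul_inv]
        exact add_le_add (mul_le_mul_of_nonneg_left (le_max_right _ _) hL.le)
          (mul_le_mul_of_nonneg_left (le_max_left _ _) hK'0)
      have h4 := mul_le_mul_of_nonneg_left h3 hC.le
      linarith
    · rw [ENNReal.ofReal_lt_ofReal_iff hε, hK]
      rw [one_div_div]; linarith
  · intro ε hε
    set K := 8 / ε with hK
    have hK0 : 0 < K := by positivity
    set K' := Real.sqrt (K * R') with hK'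
    have hK'0 : 0 ≤ K' := Real.sqrt_nonneg _
    set k1 := Real.sqrt (K * r) with hk1
    set k2 := Real.sqrt (K * L) with hk2
    set k3 := Real.sqrt (K * (L * r)) with hk3
    have hk10 : 0 ≤ k1 := Real.sqrt_nonneg _
    have hk20 : 0 ≤ k2 := Real.sqrt_nonneg _
    have hk30 : 0 ≤ k3 := Real.sqrt_nonneg _
    obtain ⟨m₀, T₀, hmT⟩ := hthr K' hK'0
    refine ⟨C * ((L + K') * (k1 + k2) + k3 + 1), by positivity, m₀, T₀, fun m T hm hT t ht1 htT => ?_⟩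
    obtain ⟨hm1, hrm, hm1', hT1, hsmall⟩ := hmT m T hm hT
    have hmR : (0 : ℝ) < m := by exact_mod_cast hm1'
    have hm1R : (1 : ℝ) ≤ m := by exact_mod_cast hm1'
    have hsm := Real.sqrt_pos.2 hmR
    have hPi := hP m T
    -- Markov for F, E, VᵀE
    have mF : P m T {ω | K * r < frobNorm (F m T t ω) ^ 2} ≤ ENNReal.ofReal (1 / K) := by
      obtain ⟨hi, he⟩ := quad_int (P m T) (χ m T t) _ (hΓχ m T t ht1 htT)
        (diagonal (fun j => (Real.sqrt (μ m T j))⁻¹) * (V m T)ᵀ)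
      simp only [← hF] at hi he
      refine markov_real (P m T) _ hi (fun ω => sq_nonneg _) r K hrR hK0 ?_
      rw [he, transpose_mul, transpose_transpose, diagonal_transpose]
      have e : diagonal (fun j => (Real.sqrt (μ m T j))⁻¹) * (V m T)ᵀ
          * (V m T * diagonal (μ m T) * (V m T)ᵀ)
          * (V m T * diagonal (fun j => (Real.sqrt (μ m T j))⁻¹)) = 1 := by
        have hv := hVorth m T hrm
        calc _ = diagonal (fun j => (Real.sqrt (μ m T j))⁻¹) * ((V m T)ᵀ * V m T)
            * diagonal (μ m T) * ((V m T)ᵀ * V m T)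
            * diagonal (fun j => (Real.sqrt (μ m T j))⁻¹) := by simp only [Matrix.mul_assoc]
          _ = 1 := by
            rw [hv, Matrix.mul_one, Matrix.mul_one, diagonal_mul_diagonal, diagonal_mul_diagonal,
              ← diagonal_one]
            congr 1; funext j
            have h1 := Real.sqrt_pos.2 (hμpos m T j)
            have h2 := Real.mul_self_sqrt (hμpos m T j).le
            field_simp
            rw [sq, h2]
      rw [e]; simp
    have mE : P m T {ω | K * (L * m) < frobNorm (Err m T t ω) ^ 2} ≤ ENNReal.ofReal (1 / K) := by
      obtain ⟨hi, he⟩ := quad_int (P m T) (Err m T t) _ (hΓE m T t ht1 htT) (1 : Matrix (Fin m) (Fin m) ℝ)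
      have h1 := htrE m T m 1
      rw [← he, frobNorm_sq_trace (1 : Matrix (Fin m) (Fin m) ℝ)] at h1
      simp only [Matrix.one_mul] at hi h1
      refine markov_real (P m T) _ hi (fun ω => sq_nonneg _) _ K (by positivity) hK0 ?_
      simpa using h1
    have mV : P m T {ω | K * (L * r) < frobNorm ((V m T)ᵀ * Err m T t ω) ^ 2}
        ≤ ENNReal.ofReal (1 / K) := by
      obtain ⟨hi, he⟩ := quad_int (P m T) (Err m T t) _ (hΓE m T t ht1 htT) (V m T)ᵀ
      have h1 := htrE m T r (V m T)ᵀ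
      rw [← he, frobNorm_transpose, frobNorm_orth _ (hVorth m T hrm), Real.sq_sqrt hrR.le] at h1
      exact markov_real (P m T) _ hi (fun ω => sq_nonneg _) _ K (by positivity) hK0 h1
    have mχ : P m T {ω | ¬ χ m T t ω = U m T * F m T t ω} = 0 := hχUF m T t hrm ht1 htT
    have mD := hmarkD m T K hm1' hT1 hK0
    set SD := {ω | Real.sqrt (K * R') * (Real.sqrt T)⁻¹ * m < frobNorm (Γhat m T ω - ΓW m T)}
    set SF := {ω | K * r < frobNorm (F m T t ω) ^ 2}
    set SE := {ω | K * (L * m) < frobNorm (Err m T t ω) ^ 2}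
    set SV := {ω | K * (L * r) < frobNorm ((V m T)ᵀ * Err m T t ω) ^ 2}
    set Sχ := {ω | ¬ χ m T t ω = U m T * F m T t ω}
    have hsub : {ω | C * ((L + K') * (k1 + k2) + k3 + 1) * max (Real.sqrt T)⁻¹ (Real.sqrt m)⁻¹
            < frobNorm (Fhat m T t ω - diagonal (fun j =>
              if 0 ≤ ((V m T)ᵀ * Vhat m T ω) j j then (1 : ℝ) else -1) * F m T t ω)}
        ⊆ (((SD ∪ SF) ∪ SE) ∪ SV) ∪ Sχ := by
      intro ω h
      by_contra hcon
      simp only [Set.mem_union, not_or] at hcon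
      obtain ⟨⟨⟨⟨nD, nF⟩, nE⟩, nV⟩, nχ⟩ := hcon
      simp only [SD, SF, SE, SV, Sχ, Set.mem_ofPred_eq, not_lt, not_not] at nD nF nE nV nχ
      have h1 := (core2 m T ω _ hm1 hrm hm1' hT1 (by positivity) nD hsmall).2 (F m T t ω) (Err m T t ω)
      rw [← hU, ← nχ, ← hW, ← hFhat] at h1
      have bF : frobNorm (F m T t ω) ≤ k1 := Real.le_sqrt_of_sq_le nF
      have bE : frobNorm (Err m T t ω) ≤ k2 * Real.sqrt m := by
        rw [hk2, ← Real.sqrt_mul (by positivity)]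
        exact Real.le_sqrt_of_sq_le (by linarith)
      have bV : frobNorm ((V m T)ᵀ * Err m T t ω) ≤ k3 := Real.le_sqrt_of_sq_le nV
      set ρ := max (Real.sqrt T)⁻¹ (Real.sqrt m)⁻¹ with hρ
      have hρm : (Real.sqrt m)⁻¹ ≤ ρ := le_max_right _ _
      have hρ0 : 0 ≤ ρ := le_trans (by positivity) hρm
      have hminv : ((m : ℝ))⁻¹ ≤ (Real.sqrt m)⁻¹ := by
        apply inv_anti₀ hsm
        rw [Real.sqrt_le_left hmR.le]
        nlinarith
      have hβ : L / m + K' * (Real.sqrt T)⁻¹ ≤ (L + K') * ρ := by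
        rw [add_mul, div_eq_mul_inv]
        exact add_le_add (mul_le_mul_of_nonneg_left (hminv.trans hρm) hL.le)
          (mul_le_mul_of_nonneg_left (le_max_left _ _) hK'0)
      have hβ0 : 0 ≤ L / m + K' * (Real.sqrt T)⁻¹ := by positivity
      have h2 : C * ((L / m + K' * (Real.sqrt T)⁻¹) * frobNorm (F m T t ω)
          + (Real.sqrt m)⁻¹ * ((L / m + K' * (Real.sqrt T)⁻¹) * frobNorm (Err m T t ω)
            + frobNorm ((V m T)ᵀ * Err m T t ω)))
          ≤ C * (((L + K') * ρ) * k1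
          + (Real.sqrt m)⁻¹ * (((L + K') * ρ) * (k2 * Real.sqrt m) + k3)) := by
        have := frobNorm_nonneg (F m T t ω)
        have := frobNorm_nonneg (Err m T t ω)
        gcongr
      have h3 : (Real.sqrt m)⁻¹ * (((L + K') * ρ) * (k2 * Real.sqrt m) + k3)
          ≤ (L + K') * ρ * k2 + ρ * k3 := by
        have e : (Real.sqrt m)⁻¹ * (((L + K') * ρ) * (k2 * Real.sqrt m) + k3)
            = (L + K') * ρ * k2 + (Real.sqrt m)⁻¹ * k3 := by field_simp
        rw [e]
        gcongr
      have h4 : C * (((L + K') * ρ) * k1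
          + (Real.sqrt m)⁻¹ * (((L + K') * ρ) * (k2 * Real.sqrt m) + k3))
          ≤ C * ((L + K') * (k1 + k2) + k3 + 1) * ρ := by
        rw [mul_assoc C]
        apply mul_le_mul_of_nonneg_left _ hC.le
        have e : ((L + K') * (k1 + k2) + k3 + 1) * ρ
            = (L + K') * ρ * k1 + ((L + K') * ρ * k2 + ρ * k3) + ρ := by ring
        rw [e]
        linarith
      have h5 : C * ((L + K') * (k1 + k2) + k3 + 1) * ρ
            < frobNorm (Fhat m T t ω - diagonal (fun j =>
              if 0 ≤ ((V m T)ᵀ * Vhat m T ω) j j then (1 : ℝ) else -1) * F m T t ω) := h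
      linarith
    have hq : (0 : ℝ) ≤ 1 / K := by positivity
    calc _ ≤ P m T ((((SD ∪ SF) ∪ SE) ∪ SV) ∪ Sχ) := measure_mono hsub
      _ ≤ P m T SD + P m T SF + P m T SE + P m T SV + P m T Sχ :=
          (measure_union_le _ _).trans (add_le_add_left ((measure_union_le _ _).trans
            (add_le_add_left ((measure_union_le _ _).trans
              (add_le_add_left (measure_union_le _ _) _)) _)) _)
      _ ≤ ENNReal.ofReal (1 / K) + ENNReal.ofReal (1 / K) + ENNReal.ofReal (1 / K)
          + ENNReal.ofReal (1 / K) + 0 := by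
          rw [mχ]; gcongr
      _ = ENNReal.ofReal (1 / K + 1 / K + 1 / K + 1 / K) := by
          rw [add_zero, ENNReal.ofReal_add (by positivity) hq, ENNReal.ofReal_add (by positivity) hq,
            ENNReal.ofReal_add hq hq]
      _ < ENNReal.ofReal ε := by
          rw [ENNReal.ofReal_lt_ofReal_iff hε, hK, one_div_div]; linarith
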